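/- (End-padding.) Let D be a byte pair dictionary over alphabet Σ, let z be a symbol not in Σ (so z occurs in no rule of D), and let k ≥ 0. Then for every string w over Σ, 𝕋^D(w z^k) = 𝕋^D(w)⌢z⌢…⌢z, where the tokenization ends with k single-symbol tokens z. -/

import Mathlib

/-!
Formalization of byte pair encoding (BPE) tokenization semantics.

* The alphabet is a type `α`.
* A *token* is a (intended nonempty) string over `α`, i.e. a `List α`.
* A *tokenization* is a finite sequence of tokens.
* A *byte pair dictionary* is a finite sequence of rules (pairs of tokens),
  listed in order of decreasing priority.
-/

/-- A token: a string over the alphabet `α`. -/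
abbrev Token (α : Type*) := List α

/-- A tokenization: a finite sequence of tokens. -/
abbrev Tok (α : Type*) := List (Token α)

/-- A byte pair dictionary: a finite sequence of rules, in decreasing priority order. -/
abbrev Dict (α : Type*) := List (Token α × Token α)

variable {α : Type*}

/-- `π`: concatenation of the tokens of a tokenization. -/
def pi (τ : Tok α) : List α := τ.flatten

/-- All tokens of a tokenization are nonempty strings. -/
def NETok (τ : Tok α) : Prop := ∀ u ∈ τ, u ≠ []

/-- All rules of a dictionary consist of nonempty tokens. -/
def NEDict (D : Dict α) : Prop := ∀ r ∈ D, r.1 ≠ [] ∧ r.2 ≠ []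

/-- `Tk∅(w)`: the initial tokenization of `w` into single symbols. -/
def TkEmpty (w : List α) : Tok α := w.map (fun a => [a])

/-- Rule `r` applies in tokenization `τ` at position `p`
(i.e. `τ = φ ⌢ r.1 ⌢ r.2 ⌢ φ'` with `|φ| = p`). -/
def AppliesAt (r : Token α × Token α) (τ : Tok α) (p : ℕ) : Prop :=
  ∃ φ φ' : Tok α, φ.length = p ∧ τ = φ ++ r.1 :: r.2 :: φ'

/-- Rule `r` applies somewhere in tokenization `τ`. -/
def Applies (r : Token α × Token α) (τ : Tok α) : Prop := ∃ p, AppliesAt r τ p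

/-- The result of applying (merging by) rule `r` at position `p` in `τ`. -/
def applyAt (r : Token α × Token α) (τ : Tok α) (p : ℕ) : Tok α :=
  τ.take p ++ (r.1 ++ r.2) :: τ.drop (p + 2)

/-- The base (nondeterministic) rewriting step `τ ⇒ τ'`: some rule of `D`
is applied somewhere in `τ`. -/
def BStep (D : Dict α) (τ τ' : Tok α) : Prop :=
  ∃ (φ φ' : Tok α) (u v : Token α),
    (u, v) ∈ D ∧ τ = φ ++ u :: v :: φ' ∧ τ' = φ ++ (u ++ v) :: φ'

/-- `τ` is a base tokenization of `w`: reachable from `Tk∅(w)` by base steps,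
and no rule of `D` applies to it. -/
def IsBase (D : Dict α) (w : List α) (τ : Tok α) : Prop :=
  Relation.ReflTransGen (BStep D) (TkEmpty w) τ ∧ ∀ τ', ¬ BStep D τ τ'

/-- `BStepN D n τ τ'`: `τ'` is obtained from `τ` by exactly `n` base steps. -/
def BStepN (D : Dict α) : ℕ → Tok α → Tok α → Prop
  | 0 => Eq
  | n + 1 => fun τ τ'' => ∃ τ', BStepN D n τ τ' ∧ BStep D τ' τ''

/-- One SentencePiece step applying the rule of index `i` (highest priority
applicable) at position `p` (leftmost occurrence of that rule). -/
def SPStepAt (D : Dict α) (i p : ℕ) (τ τ' : Tok α) : Prop :=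
  ∃ h : i < D.length,
    AppliesAt (D[i]'h) τ p ∧
    (∀ (j : ℕ) (hj : j < D.length), j < i → ¬ Applies (D[j]'hj) τ) ∧
    (∀ q < p, ¬ AppliesAt (D[i]'h) τ q) ∧
    τ' = applyAt (D[i]'h) τ p

/-- One SentencePiece step: the highest priority applicable rule is applied
at its leftmost occurrence. -/
def SPStep (D : Dict α) (τ τ' : Tok α) : Prop := ∃ i p, SPStepAt D i p τ τ'

/-- One SentencePiece step which applies the rule `r` of `D`. -/
def SPStepRule (D : Dict α) (r : Token α × Token α) (τ τ' : Tok α) : Prop :=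
  ∃ (i p : ℕ) (h : i < D.length), D[i]'h = r ∧ SPStepAt D i p τ τ'

/-- `τ` is the SentencePiece tokenization `𝕋^D(w)` of `w`: reachable from
`Tk∅(w)` by SentencePiece steps, and no further step applies. -/
def IsSP (D : Dict α) (w : List α) (τ : Tok α) : Prop :=
  Relation.ReflTransGen (SPStep D) (TkEmpty w) τ ∧ ∀ τ', ¬ SPStep D τ τ'

/-- One application of rule `r` at its leftmost occurrence. -/
def LeftStep (r : Token α × Token α) (τ τ' : Tok α) : Prop :=
  ∃ p, AppliesAt r τ p ∧ (∀ q < p, ¬ AppliesAt r τ q) ∧ τ' = applyAt r τ p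

/-- Exhaustive application of rule `r`, leftmost first, until it no longer applies. -/
def Exhaust (r : Token α × Token α) (τ τ' : Tok α) : Prop :=
  Relation.ReflTransGen (LeftStep r) τ τ' ∧ ¬ Applies r τ'

/-- One HuggingFace (macro) step using the rule of index `i`: the rule of
index `i` is the highest-priority applicable rule, and it is applied
repeatedly at its leftmost occurrence until it no longer applies. -/
def HFStepAt (D : Dict α) (i : ℕ) (τ τ' : Tok α) : Prop :=
  ∃ h : i < D.length,
    Applies (D[i]'h) τ ∧
    (∀ (j : ℕ) (hj : j < D.length), j < i → ¬ Applies (D[j]'hj) τ) ∧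
    Exhaust (D[i]'h) τ τ'

/-- One HuggingFace (macro) step. -/
def HFStep (D : Dict α) (τ τ' : Tok α) : Prop := ∃ i, HFStepAt D i τ τ'

/-- One HuggingFace (macro) step which uses the rule `r` of `D`. -/
def HFStepRule (D : Dict α) (r : Token α × Token α) (τ τ' : Tok α) : Prop :=
  ∃ (i : ℕ) (h : i < D.length), D[i]'h = r ∧ HFStepAt D i τ τ'

/-- `τ` is the HuggingFace tokenization `𝕋_hf^D(w)` of `w`. -/
def IsHF (D : Dict α) (w : List α) (τ : Tok α) : Prop :=
  Relation.ReflTransGen (HFStep D) (TkEmpty w) τ ∧ ∀ τ', ¬ HFStep D τ τ'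

/-- A dictionary is *proper* if each side of each rule of length `> 1` is
produced by some higher-priority rule. -/
def Proper (D : Dict α) : Prop :=
  ∀ (j : ℕ) (hj : j < D.length),
    (1 < (D[j]'hj).1.length →
      ∃ (i : ℕ) (hi : i < D.length), i < j ∧ (D[j]'hj).1 = (D[i]'hi).1 ++ (D[i]'hi).2) ∧
    (1 < (D[j]'hj).2.length →
      ∃ (i : ℕ) (hi : i < D.length), i < j ∧ (D[j]'hj).2 = (D[i]'hi).1 ++ (D[i]'hi).2)

/-- `max{|uv| : u⌢v ∈ D}`: the maximal total length of a rule of `D`. -/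
def maxPairLen (D : Dict α) : ℕ := (D.map (fun r => (r.1 ++ r.2).length)).foldr max 0

/-- `l` is a sufficient lookahead bound for `D`: whenever `𝕋^D(π(φ)π(τ)) = φ⌢τ` with
`|π(τ)| ≥ l`, appending any further text keeps `φ` as a prefix of the tokenization. -/
def GoodLookahead (D : Dict α) (l : ℕ) : Prop :=
  ∀ φ τ ψ : Tok α, l ≤ (pi τ).length →
    IsSP D (pi φ ++ pi τ) (φ ++ τ) →
    ∃ ψ', IsSP D (pi φ ++ pi τ ++ pi ψ) (φ ++ ψ')

/-- The lookahead constant `l(D)`: the smallest sufficient lookahead bound. -/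
noncomputable def lookaheadConst (D : Dict α) : ℕ := sInf {l | GoodLookahead D l}

theorem appliesAt_iff_getElem? (r : Token α × Token α) (τ : Tok α) (p : ℕ) :
    AppliesAt r τ p ↔ τ[p]? = some r.1 ∧ τ[p + 1]? = some r.2 := by
  constructor
  · rintro ⟨φ, φ', rfl, rfl⟩
    simp
  · rintro ⟨h₁, h₂⟩
    obtain ⟨hp₁, h₁⟩ := List.getElem?_eq_some_iff.mp h₁
    obtain ⟨hp₂, h₂⟩ := List.getElem?_eq_some_iff.mp h₂
    refine ⟨τ.take p, τ.drop (p + 2), by simp; omega, ?_⟩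
    rw [← h₁, ← h₂, ← List.drop_eq_getElem_cons, ← List.drop_eq_getElem_cons,
      List.take_append_drop]

theorem AppliesAt.add_two_le_length {r : Token α × Token α} {τ : Tok α} {p : ℕ}
    (h : AppliesAt r τ p) : p + 2 ≤ τ.length := by
  obtain ⟨φ, φ', rfl, rfl⟩ := h
  simp

theorem appliesAt_append_replicate_iff {r : Token α × Token α} {t : Token α}
    (h₁ : r.1 ≠ t) (h₂ : r.2 ≠ t) (τ : Tok α) (k p : ℕ) :
    AppliesAt r (τ ++ List.replicate k t) p ↔ AppliesAt r τ p := by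
  have key : ∀ (q : ℕ) (u : Token α), u ≠ t →
      ((τ ++ List.replicate k t)[q]? = some u ↔ τ[q]? = some u) := by
    intro q u hu
    rcases lt_or_ge q τ.length with hq | hq
    · rw [List.getElem?_append_left hq]
    · rw [List.getElem?_append_right hq, List.getElem?_eq_none hq, List.getElem?_replicate]
      split_ifs <;> simp [hu.symm]
  rw [appliesAt_iff_getElem?, appliesAt_iff_getElem?, key _ _ h₁, key _ _ h₂]

theorem AppliesAt.applyAt_append {r : Token α × Token α} {τ : Tok α} {p : ℕ}
    (h : AppliesAt r τ p) (σ : Tok α) : applyAt r (τ ++ σ) p = applyAt r τ p ++ σ := by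
  have hp := h.add_two_le_length
  rw [applyAt, applyAt, List.take_append_of_le_length (by omega),
    List.drop_append_of_le_length hp]
  simp

theorem spStep_append_replicate_iff {D : Dict α} {t : Token α}
    (ht : ∀ r ∈ D, r.1 ≠ t ∧ r.2 ≠ t) (τ τ₁ : Tok α) (k : ℕ) :
    SPStep D (τ ++ List.replicate k t) τ₁ ↔
      ∃ τ', SPStep D τ τ' ∧ τ₁ = τ' ++ List.replicate k t := by
  have key : ∀ (j : ℕ) (hj : j < D.length) (q : ℕ),
      AppliesAt (D[j]'hj) (τ ++ List.replicate k t) q ↔ AppliesAt (D[j]'hj) τ q :=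
    fun j hj q => appliesAt_append_replicate_iff (ht _ (List.getElem_mem hj)).1
      (ht _ (List.getElem_mem hj)).2 τ k q
  simp only [SPStep, SPStepAt, Applies, key]
  constructor
  · rintro ⟨i, p, hi, ha, hprio, hleft, rfl⟩
    exact ⟨_, ⟨i, p, hi, ha, hprio, hleft, rfl⟩, ha.applyAt_append _⟩
  · rintro ⟨_, ⟨i, p, hi, ha, hprio, hleft, rfl⟩, rfl⟩
    exact ⟨i, p, hi, ha, hprio, hleft, (ha.applyAt_append _).symm⟩

/-- End-padding: if the symbol `z` occurs in no rule of `D` and not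
in `w`, then `𝕋^D(w z^k) = 𝕋^D(w) ⌢ z ⌢ … ⌢ z` (with `k` trailing single-symbol
tokens `z`). -/
theorem end_padding (D : Dict α) (hD : NEDict D) (z : α)
    (hz : ∀ r ∈ D, z ∉ r.1 ∧ z ∉ r.2)
    (w : List α) (hw : z ∉ w) (k : ℕ) (τ : Tok α) (h : IsSP D w τ) :
    IsSP D (w ++ List.replicate k z) (τ ++ List.replicate k ([z] : Token α)) := by
  have ht : ∀ r ∈ D, r.1 ≠ [z] ∧ r.2 ≠ [z] := fun r hr =>
    ⟨fun e => (hz r hr).1 (by simp [e]), fun e => (hz r hr).2 (by simp [e])⟩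
  refine ⟨?_, fun τ₁ hstep => ?_⟩
  · have hlift := h.1.lift (p := SPStep D) (· ++ List.replicate k ([z] : Token α))
      fun τ₀ τ' hs => (spStep_append_replicate_iff ht τ₀ _ k).mpr ⟨τ', hs, rfl⟩
    simpa [TkEmpty] using hlift
  · obtain ⟨τ', hs, -⟩ := (spStep_append_replicate_iff ht τ τ₁ k).mp hstep
    exact h.2 τ' hs
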